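/- arXiv:2412.00620 — 5 statements merged into one kernel-verified Lean document; each statement's English description precedes it below -/
import Mathlib

section
/- For every ε > 0, the mean squared error of the distance perturbation mechanism M− at input 0, defined as MSE(0) = ∫₀¹ y² g₀(y) dy, equals 8C_ε³p_ε/3 + (1 − 8C_ε³)·p_ε/(3·exp(ε)), where p_ε = exp(ε/2) and C_ε = (exp(ε/2)−1)/(2·exp(ε)−2). -/
open Real

/-- Sampling probability density of the distance perturbation mechanism. -/
noncomputable def distP (ε : ℝ) : ℝ := Real.exp (ε / 2)

/-- The constant `C_ε` of the distance perturbation mechanism. -/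
noncomputable def distC (ε : ℝ) : ℝ := (Real.exp (ε / 2) - 1) / (2 * Real.exp ε - 2)

/-- The sampling interval `[u, v)` of the distance perturbation mechanism `M−`
with input `x`, given as the pair `(u, v)`. -/
noncomputable def distInterval (ε x : ℝ) : ℝ × ℝ :=
  if distC ε ≤ x ∧ x < 1 - distC ε then (x - distC ε, x + distC ε)
  else if 0 ≤ x ∧ x < distC ε then (0, 2 * distC ε)
  else (1 - 2 * distC ε, 1)

/-- Output density of the distance perturbation mechanism `M−` with input `x`. -/
noncomputable def distDensity (ε x y : ℝ) : ℝ :=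
  if (distInterval ε x).1 ≤ y ∧ y < (distInterval ε x).2 then Real.exp (ε / 2)
  else Real.exp (ε / 2) / Real.exp ε

lemma distC_eq {ε : ℝ} (hε : 0 < ε) : distC ε = 1 / (2 * (Real.exp (ε / 2) + 1)) := by
  have h1 : 1 < Real.exp (ε / 2) := Real.one_lt_exp_iff.mpr (by linarith)
  have h2 : Real.exp ε = Real.exp (ε / 2) ^ 2 := by
    rw [← Real.exp_nat_mul]
    congr 1
    push_cast
    ring
  have h3 : 2 * Real.exp (ε / 2) ^ 2 - 2 ≠ 0 := by nlinarith
  rw [distC, h2, div_eq_div_iff h3 (by positivity)]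
  ring

lemma distC_pos {ε : ℝ} (hε : 0 < ε) : 0 < distC ε := by
  rw [distC_eq hε]
  positivity

lemma two_mul_distC_lt_one {ε : ℝ} (hε : 0 < ε) : 2 * distC ε < 1 := by
  have h := Real.exp_pos (ε / 2)
  rw [distC_eq hε, mul_one_div, div_lt_one (by positivity)]
  linarith

lemma distInterval_zero {ε : ℝ} (hε : 0 < ε) : distInterval ε 0 = (0, 2 * distC ε) := by
  have h := distC_pos hε
  simp [distInterval, h, h.not_ge]

/-- The second moment over `[0, 1]` of a step function with a jump at `c`. -/
lemma integral_sq_mul_of_step {f : ℝ → ℝ} {a b c : ℝ} (hc : 0 ≤ c) (hc' : c ≤ 1)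
    (hl : ∀ y, 0 ≤ y → y < c → f y = a) (hr : ∀ y, c ≤ y → f y = b) :
    ∫ y in (0 : ℝ)..1, y ^ 2 * f y = c ^ 3 * a / 3 + (1 - c ^ 3) * b / 3 := by
  have hleft : Set.EqOn (fun y => y ^ 2 * a) (fun y => y ^ 2 * f y) (Set.uIoo 0 c) := by
    intro y hy
    rw [Set.uIoo_of_le hc] at hy
    simp only [hl y hy.1.le hy.2]
  have hright : Set.EqOn (fun y => y ^ 2 * b) (fun y => y ^ 2 * f y) (Set.uIoo c 1) := by
    intro y hy
    rw [Set.uIoo_of_le hc'] at hy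
    simp only [hr y hy.1.le]
  have hint (k s t : ℝ) : IntervalIntegrable (fun y => y ^ 2 * k) MeasureTheory.volume s t :=
    Continuous.intervalIntegrable (by fun_prop) s t
  rw [← intervalIntegral.integral_add_adjacent_intervals
      ((hint a 0 c).congr_uIoo hleft) ((hint b c 1).congr_uIoo hright),
    ← intervalIntegral.integral_congr_uIoo hleft, ← intervalIntegral.integral_congr_uIoo hright]
  simp only [intervalIntegral.integral_mul_const, integral_pow]
  norm_num
  ring

/-- The mean squared error of `M−` at input `0` equals
`8C_ε³p_ε/3 + (1 − 8C_ε³)·p_ε/(3·exp ε)`. -/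
theorem dist_MSE_at_zero (ε : ℝ) (hε : 0 < ε) :
    (∫ y in (0:ℝ)..1, y ^ 2 * distDensity ε 0 y)
      = 8 * distC ε ^ 3 * distP ε / 3
        + (1 - 8 * distC ε ^ 3) * distP ε / (3 * Real.exp ε) := by
  have hC := distC_pos hε
  rw [integral_sq_mul_of_step (a := distP ε) (b := distP ε / Real.exp ε) (c := 2 * distC ε)
    (by linarith) (two_mul_distC_lt_one hε).le]
  · field_simp
    ring
  · intro y h0 hy
    simp [distDensity, distInterval_zero hε, distP, h0, hy]
  · intro y hy
    simp [distDensity, distInterval_zero hε, distP, hy.not_gt]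
end

section
/- For every ε > 0, the worst-case mean squared error of the direction perturbation mechanism M∘ under squared circular distance converges to zero at rate Θ(exp(−ε/2)): the mean squared error MSE∘(φ) = ∫₀^{2π} d(φ',φ)² f_φ(φ') dφ' (with d the circular distance) is the same for every input φ, and exp(ε/2)·MSE∘(φ) → π²/3 as ε → ∞. -/
open Real Filter

/-- Circular distance on `[0, 2π)`. -/
noncomputable def circDist (x y : ℝ) : ℝ := min |x - y| (2 * π - |x - y|)

/-- Sampling probability density of the direction perturbation mechanism. -/
noncomputable def dirP (ε : ℝ) : ℝ := Real.exp (ε / 2) / (2 * π)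

/-- Width of the dominant sector of the direction perturbation mechanism. -/
noncomputable def dirW (ε : ℝ) : ℝ := 2 * π * (Real.exp (ε / 2) - 1) / (Real.exp ε - 1)

/-- Output density of the direction perturbation mechanism `M∘` with input `φ`. -/
noncomputable def dirDensity (ε φ φ' : ℝ) : ℝ :=
  if circDist φ' φ < dirW ε / 2 then dirP ε else dirP ε / Real.exp ε

/-- Mean squared error of `M∘` at input `φ` under squared circular distance. -/
noncomputable def dirMSE (ε φ : ℝ) : ℝ :=
  ∫ φ' in (0:ℝ)..(2 * π), circDist φ' φ ^ 2 * dirDensity ε φ φ'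

open MeasureTheory intervalIntegral

/-- The integral of a function of the circular distance to a fixed point of the circle is twice
its integral over `[0, π]`. -/
theorem integral_comp_circDist {F : ℝ → ℝ} {φ : ℝ} (hφ : φ ∈ Set.Ico 0 (2 * π))
    (hF : ∀ a b : ℝ, IntervalIntegrable (fun u => F (circDist u 0)) volume a b) :
    ∫ x in (0 : ℝ)..(2 * π), F (circDist x φ) = 2 * ∫ t in (0 : ℝ)..π, F t := by
  obtain ⟨h0, h1⟩ := hφ
  have hπ := Real.pi_pos
  set H : ℝ → ℝ := fun u => F (circDist u 0) with hH
  have shift : ∫ x in (0 : ℝ)..(2 * π), F (circDist x φ) = ∫ u in (-φ)..(2 * π - φ), H u := by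
    have := intervalIntegral.integral_comp_sub_right (a := 0) (b := 2 * π) H φ
    rw [zero_sub] at this
    rw [← this]
    simp only [hH, circDist, sub_zero]
  have wrap : ∫ u in (-φ)..0, H u = ∫ u in (2 * π - φ)..(2 * π), H u := by
    have := intervalIntegral.integral_comp_add_right (a := -φ) (b := 0) H (2 * π)
    rw [zero_add, neg_add_eq_sub] at this
    rw [← this]
    refine intervalIntegral.integral_congr fun u hu => ?_
    rw [Set.uIcc_of_le (by linarith)] at hu
    obtain ⟨hu0, hu1⟩ := hu
    simp only [hH, circDist, sub_zero]
    rw [abs_of_nonpos hu1, abs_of_nonneg (show 0 ≤ u + 2 * π by linarith), min_comm]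
    congr 2 <;> ring
  have near : ∫ u in (0 : ℝ)..π, H u = ∫ t in (0 : ℝ)..π, F t := by
    refine intervalIntegral.integral_congr fun u hu => ?_
    rw [Set.uIcc_of_le hπ.le] at hu
    simp only [hH, circDist, sub_zero]
    rw [abs_of_nonneg hu.1, min_eq_left (by linarith [hu.2])]
  have far : ∫ u in π..(2 * π), H u = ∫ t in (0 : ℝ)..π, F t := by
    have := intervalIntegral.integral_comp_sub_left (a := 0) (b := π) H (2 * π)
    rw [sub_zero, show 2 * π - π = π by ring] at this
    rw [← this]
    refine intervalIntegral.integral_congr fun u hu => ?_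
    rw [Set.uIcc_of_le hπ.le] at hu
    simp only [hH, circDist, sub_zero]
    rw [abs_of_nonneg (by linarith [hu.2]), min_eq_right (by linarith [hu.2]), sub_sub_cancel]
  rw [shift, ← integral_add_adjacent_intervals (hF (-φ) 0) (hF 0 (2 * π - φ)), wrap, add_comm,
    integral_add_adjacent_intervals (hF _ _) (hF _ _),
    ← integral_add_adjacent_intervals (hF 0 π) (hF π (2 * π)), near, far]
  ring

theorem intervalIntegrable_sq_mul_step {m : ℝ → ℝ} (hm : Continuous m) (w p q a b : ℝ) :
    IntervalIntegrable (fun u => m u ^ 2 * if m u < w then p else q) volume a b := by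
  have hsq : IntervalIntegrable (fun u => m u ^ 2) volume a b := (hm.pow 2).intervalIntegrable a b
  have hmeas : Measurable fun u => if m u < w then p else q :=
    Measurable.ite (measurableSet_lt hm.measurable measurable_const) measurable_const
      measurable_const
  have hbound : ∀ u, ‖if m u < w then p else q‖ ≤ max ‖p‖ ‖q‖ := fun u => by
    split_ifs
    · exact le_max_left _ _
    · exact le_max_right _ _
  rw [intervalIntegrable_iff] at hsq ⊢
  exact hsq.mul_bdd (c := max ‖p‖ ‖q‖) hmeas.aestronglyMeasurable (ae_of_all _ hbound)

theorem integral_sq_mul_step {w c : ℝ} (hw : 0 ≤ w) (hwc : w ≤ c) (p q : ℝ) :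
    ∫ t in (0 : ℝ)..c, t ^ 2 * (if t < w then p else q) =
      p * w ^ 3 / 3 + q * (c ^ 3 - w ^ 3) / 3 := by
  have hint := intervalIntegrable_sq_mul_step continuous_id w p q
  simp only [id] at hint
  have below : ∫ t in (0 : ℝ)..w, t ^ 2 * (if t < w then p else q) =
      ∫ t in (0 : ℝ)..w, t ^ 2 * p := by
    refine intervalIntegral.integral_congr_ae ?_
    filter_upwards [Measure.ae_ne volume w] with t ht hmem
    rw [Set.uIoc_of_le hw] at hmem
    rw [if_pos (lt_of_le_of_ne hmem.2 ht)]
  have above : ∫ t in w..c, t ^ 2 * (if t < w then p else q) = ∫ t in w..c, t ^ 2 * q := by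
    refine intervalIntegral.integral_congr fun t ht => ?_
    rw [Set.uIcc_of_le hwc] at ht
    simp only [if_neg (not_lt.mpr ht.1)]
  rw [← integral_add_adjacent_intervals (hint 0 w) (hint w c), below, above,
    intervalIntegral.integral_mul_const, intervalIntegral.integral_mul_const, integral_pow,
    integral_pow]
  norm_num
  ring

/-- Closed form of the mean squared error. -/
theorem exp_half_mul_dirMSE {ε φ : ℝ} (hε : 0 < ε) (hφ : φ ∈ Set.Ico 0 (2 * π)) :
    Real.exp (ε / 2) * dirMSE ε φ =
      π ^ 2 / 3 * ((1 - (Real.exp (ε / 2) + 1)⁻¹) ^ 2 * (Real.exp (ε / 2) + 1)⁻¹ +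
        (1 - (Real.exp (ε / 2) + 1)⁻¹ ^ 3)) := by
  have hπ := Real.pi_pos
  have hE : 1 < Real.exp (ε / 2) := Real.one_lt_exp_iff.mpr (by linarith)
  have hsq : Real.exp ε = Real.exp (ε / 2) ^ 2 := by
    rw [← Real.exp_nat_mul]
    congr 1
    push_cast
    ring
  have hw : dirW ε / 2 = π / (Real.exp (ε / 2) + 1) := by
    rw [dirW, hsq]
    have h1 : Real.exp (ε / 2) - 1 ≠ 0 := by linarith
    have h2 : Real.exp (ε / 2) + 1 ≠ 0 := by linarith
    rw [show Real.exp (ε / 2) ^ 2 - 1 = (Real.exp (ε / 2) - 1) * (Real.exp (ε / 2) + 1) by ring]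
    field_simp
  have hcont : Continuous fun u : ℝ => circDist u 0 := by
    unfold circDist
    fun_prop
  have hMSE : dirMSE ε φ = 2 * ∫ t in (0 : ℝ)..π,
      t ^ 2 * (if t < dirW ε / 2 then dirP ε else dirP ε / Real.exp ε) :=
    integral_comp_circDist
      (F := fun t => t ^ 2 * (if t < dirW ε / 2 then dirP ε else dirP ε / Real.exp ε)) hφ
      (intervalIntegrable_sq_mul_step hcont _ _ _)
  rw [hMSE, integral_sq_mul_step (by rw [hw]; positivity)
    (by rw [hw]; exact div_le_self hπ.le (by linarith)), hw, dirP, hsq]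
  have h0 : Real.exp (ε / 2) ≠ 0 := by linarith
  have h2 : Real.exp (ε / 2) + 1 ≠ 0 := by linarith
  field_simp
  ring

/-- The MSE of `M∘` under squared circular distance is the same for every input,
and `exp(ε/2)·MSE∘(φ) → π²/3` as `ε → ∞`. -/
theorem dir_MSE_convergence_rate :
    (∀ ε : ℝ, 0 < ε → ∀ φ₁ φ₂ : ℝ, φ₁ ∈ Set.Ico 0 (2 * π) →
      φ₂ ∈ Set.Ico 0 (2 * π) → dirMSE ε φ₁ = dirMSE ε φ₂) ∧
    (∀ φ : ℝ, φ ∈ Set.Ico 0 (2 * π) →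
      Tendsto (fun ε : ℝ => Real.exp (ε / 2) * dirMSE ε φ) atTop
        (nhds (π ^ 2 / 3))) := by
  refine ⟨fun ε hε φ₁ φ₂ h₁ h₂ => ?_, fun φ hφ => ?_⟩
  · apply mul_left_cancel₀ (Real.exp_ne_zero (ε / 2))
    rw [exp_half_mul_dirMSE hε h₁, exp_half_mul_dirMSE hε h₂]
  · have hinv : Tendsto (fun ε : ℝ => (Real.exp (ε / 2) + 1)⁻¹) atTop (nhds 0) :=
      (tendsto_atTop_add_const_right _ _
        (Real.tendsto_exp_atTop.comp (tendsto_id.atTop_div_const two_pos))).inv_tendsto_atTop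
    have hlim := ((((hinv.const_sub 1).pow 2).mul hinv).add
      ((hinv.pow 3).const_sub 1)).const_mul (π ^ 2 / 3)
    simp only [sub_zero, one_pow, mul_zero, zero_add, ne_eq, OfNat.ofNat_ne_zero,
      not_false_eq_true, zero_pow, mul_one] at hlim
    refine hlim.congr' ?_
    filter_upwards [eventually_gt_atTop 0] with ε hε
    exact (exp_half_mul_dirMSE hε hφ).symm
end

section
/- Sequential composition for the direction–distance perturbation (per-location guarantee of TraCS-D): for every ε > 0 and every ε_d with 0 < ε_d < ε, the joint mechanism that, given a private pair (φ, x) ∈ [0,2π) × [0,1), outputs (φ', y) with joint density f_φ(φ')·g_x(y), where f_φ is the density of the direction perturbation mechanism M∘ with parameter ε_d and g_x is the density of the distance perturbation mechanism M− with parameter ε − ε_d, satisfies ε-LDP: for all (φ₁,x₁), (φ₂,x₂) ∈ [0,2π)×[0,1) and all (φ*,y*) ∈ [0,2π)×[0,1), f_{φ₁}(φ*)·g_{x₁}(y*) ≤ exp(ε) · f_{φ₂}(φ*)·g_{x₂}(y*). -/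
open Real

/-- A density taking the two values `p` and `p / exp ε` varies by a factor of at most `exp ε`. -/
lemma ite_div_exp_le_exp_mul_ite {p ε : ℝ} (hp : 0 ≤ p) (hε : 0 ≤ ε) (a b : Prop)
    [Decidable a] [Decidable b] :
    (if a then p else p / Real.exp ε) ≤ Real.exp ε * (if b then p else p / Real.exp ε) := by
  have h1 : 1 ≤ Real.exp ε := Real.one_le_exp hε
  have hdiv : p / Real.exp ε ≤ p := div_le_self hp h1
  have hle : (if a then p else p / Real.exp ε) ≤ p := by split_ifs <;> simp [hdiv]
  have hge : p / Real.exp ε ≤ (if b then p else p / Real.exp ε) := by split_ifs <;> simp [hdiv]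
  calc (if a then p else p / Real.exp ε) ≤ p := hle
    _ = Real.exp ε * (p / Real.exp ε) := (mul_div_cancel₀ p (Real.exp_pos ε).ne').symm
    _ ≤ _ := mul_le_mul_of_nonneg_left hge (Real.exp_pos ε).le

lemma dirP_nonneg (ε : ℝ) : 0 ≤ dirP ε := by
  unfold dirP
  positivity

lemma dirDensity_nonneg (ε φ φ' : ℝ) : 0 ≤ dirDensity ε φ φ' := by
  have := dirP_nonneg ε
  unfold dirDensity
  split_ifs <;> positivity

lemma distDensity_nonneg (ε x y : ℝ) : 0 ≤ distDensity ε x y := by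
  unfold distDensity
  split_ifs <;> positivity

/-- The direction perturbation mechanism satisfies `ε`-LDP. -/
lemma dirDensity_le_exp_mul {ε : ℝ} (hε : 0 ≤ ε) (φ₁ φ₂ φ' : ℝ) :
    dirDensity ε φ₁ φ' ≤ Real.exp ε * dirDensity ε φ₂ φ' :=
  ite_div_exp_le_exp_mul_ite (dirP_nonneg ε) hε _ _

/-- The distance perturbation mechanism satisfies `ε`-LDP. -/
lemma distDensity_le_exp_mul {ε : ℝ} (hε : 0 ≤ ε) (x₁ x₂ y : ℝ) :
    distDensity ε x₁ y ≤ Real.exp ε * distDensity ε x₂ y :=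
  ite_div_exp_le_exp_mul_ite (Real.exp_pos _).le hε _ _

/-- Sequential composition for the direction–distance perturbation (per-location
guarantee of TraCS-D): the joint mechanism `(M∘ with parameter ε_d, M− with
parameter ε − ε_d)` satisfies `ε`-LDP. -/
theorem tracsD_per_location_LDP (ε εd : ℝ) (hεd : 0 < εd) (hεdε : εd < ε)
    (φ₁ φ₂ x₁ x₂ φstar ystar : ℝ)
    (hφ₁ : φ₁ ∈ Set.Ico 0 (2 * π)) (hφ₂ : φ₂ ∈ Set.Ico 0 (2 * π))
    (hx₁ : x₁ ∈ Set.Ico (0:ℝ) 1) (hx₂ : x₂ ∈ Set.Ico (0:ℝ) 1)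
    (hφstar : φstar ∈ Set.Ico 0 (2 * π)) (hystar : ystar ∈ Set.Ico (0:ℝ) 1) :
    dirDensity εd φ₁ φstar * distDensity (ε - εd) x₁ ystar
      ≤ Real.exp ε * (dirDensity εd φ₂ φstar * distDensity (ε - εd) x₂ ystar) := by
  calc dirDensity εd φ₁ φstar * distDensity (ε - εd) x₁ ystar
      ≤ (Real.exp εd * dirDensity εd φ₂ φstar)
          * (Real.exp (ε - εd) * distDensity (ε - εd) x₂ ystar) :=
        mul_le_mul (dirDensity_le_exp_mul hεd.le _ _ _)
          (distDensity_le_exp_mul (sub_nonneg.2 hεdε.le) _ _ _) (distDensity_nonneg _ _ _)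
          (mul_nonneg (Real.exp_pos _).le (dirDensity_nonneg _ _ _))
    _ = Real.exp ε * (dirDensity εd φ₂ φstar * distDensity (ε - εd) x₂ ystar) := by
        rw [mul_mul_mul_comm, ← Real.exp_add, add_sub_cancel]
end

section
/- The redesigned SW mechanism for direction perturbation is a valid probability density and satisfies ε-LDP: for every ε > 0, with p_ε = (exp(ε)−1)/(2πε) and W_ε = 2π(exp(ε)(ε−1)+1)/(exp(ε)−1)², the density f_φ(φ') = p_ε if the circular distance between φ' and φ is less than W_ε/2 and f_φ(φ') = p_ε/exp(ε) otherwise satisfies p_ε·W_ε + (p_ε/exp(ε))·(2π − W_ε) = 1, and f_{φ₁}(φ*) ≤ exp(ε)·f_{φ₂}(φ*) for all φ₁, φ₂, φ* ∈ [0,2π). -/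
open Real

/-- Sampling probability density of the redesigned SW direction mechanism. -/
noncomputable def swDirP (ε : ℝ) : ℝ := (Real.exp ε - 1) / (2 * π * ε)

/-- Dominant-sector width of the redesigned SW direction mechanism. -/
noncomputable def swDirW (ε : ℝ) : ℝ :=
  2 * π * (Real.exp ε * (ε - 1) + 1) / (Real.exp ε - 1) ^ 2

/-- Output density of the redesigned SW direction mechanism with input `φ`. -/
noncomputable def swDirDensity (ε φ φ' : ℝ) : ℝ :=
  if circDist φ' φ < swDirW ε / 2 then swDirP ε else swDirP ε / Real.exp ε

/-- The sampling density of the redesigned SW mechanism is positive. -/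
theorem swDirP_pos {ε : ℝ} (hε : 0 < ε) : 0 < swDirP ε := by
  have h1 : 0 < Real.exp ε - 1 := sub_pos.2 (Real.one_lt_exp_iff.2 hε)
  unfold swDirP
  positivity

/-- The density is at least its value outside the dominant sector. -/
theorem swDirP_div_exp_le_swDirDensity {ε : ℝ} (hε : 0 < ε) (φ φ' : ℝ) :
    swDirP ε / Real.exp ε ≤ swDirDensity ε φ φ' := by
  unfold swDirDensity
  split_ifs
  · exact div_le_self (swDirP_pos hε).le (Real.one_le_exp hε.le)
  · exact le_rfl

/-- The density is at most its value on the dominant sector. -/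
theorem swDirDensity_le_swDirP {ε : ℝ} (hε : 0 < ε) (φ φ' : ℝ) :
    swDirDensity ε φ φ' ≤ swDirP ε := by
  unfold swDirDensity
  split_ifs
  · exact le_rfl
  · exact div_le_self (swDirP_pos hε).le (Real.one_le_exp hε.le)

/-- The redesigned SW mechanism for direction perturbation is a valid
probability density and satisfies `ε`-LDP on the circle. -/
theorem swDir_valid_and_LDP (ε : ℝ) (hε : 0 < ε) :
    swDirP ε * swDirW ε + (swDirP ε / Real.exp ε) * (2 * π - swDirW ε) = 1 ∧
    (∀ φ₁ φ₂ φstar : ℝ, φ₁ ∈ Set.Ico 0 (2 * π) → φ₂ ∈ Set.Ico 0 (2 * π) →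
      φstar ∈ Set.Ico 0 (2 * π) →
      swDirDensity ε φ₁ φstar ≤ Real.exp ε * swDirDensity ε φ₂ φstar) := by
  constructor
  · have h1 : Real.exp ε - 1 ≠ 0 := (sub_pos.2 (Real.one_lt_exp_iff.2 hε)).ne'
    have h2 : Real.exp ε ≠ 0 := (Real.exp_pos ε).ne'
    have h3 : ε ≠ 0 := hε.ne'
    have h4 : π ≠ 0 := Real.pi_ne_zero
    unfold swDirP swDirW
    field_simp
    ring
  · intro φ₁ φ₂ φstar _ _ _
    calc swDirDensity ε φ₁ φstar ≤ swDirP ε := swDirDensity_le_swDirP hε _ _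
      _ = Real.exp ε * (swDirP ε / Real.exp ε) :=
        (mul_div_cancel₀ _ (Real.exp_pos ε).ne').symm
      _ ≤ Real.exp ε * swDirDensity ε φ₂ φstar :=
        mul_le_mul_of_nonneg_left (swDirP_div_exp_le_swDirDensity hε _ _) (Real.exp_pos ε).le
end

section
/- The redesigned SW mechanism for distance perturbation is a valid probability density and satisfies ε-LDP: for every ε > 0, with p_ε = (exp(ε)−1)/ε and C_ε = (exp(ε)(ε−1)+1)/(2(exp(ε)−1)²), the density g_x(y) = p_ε for y in the sampling interval [u,v) and g_x(y) = p_ε/exp(ε) for y ∈ [0,1)∖[u,v) satisfies p_ε·2C_ε + (p_ε/exp(ε))·(1 − 2C_ε) = 1, and g_{x₁}(y) ≤ exp(ε)·g_{x₂}(y) for all x₁, x₂ ∈ [0,1) and all y ∈ [0,1). -/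
open Real

/-- Sampling probability density of the redesigned SW distance mechanism. -/
noncomputable def swDistP (ε : ℝ) : ℝ := (Real.exp ε - 1) / ε

/-- The constant `C_ε` of the redesigned SW distance mechanism. -/
noncomputable def swDistC (ε : ℝ) : ℝ :=
  (Real.exp ε * (ε - 1) + 1) / (2 * (Real.exp ε - 1) ^ 2)

/-- The sampling interval `[u, v)` of the redesigned SW distance mechanism with
input `x`, given as the pair `(u, v)`. -/
noncomputable def swDistInterval (ε x : ℝ) : ℝ × ℝ :=
  if swDistC ε ≤ x ∧ x < 1 - swDistC ε then (x - swDistC ε, x + swDistC ε)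
  else if 0 ≤ x ∧ x < swDistC ε then (0, 2 * swDistC ε)
  else (1 - 2 * swDistC ε, 1)

/-- Output density of the redesigned SW distance mechanism with input `x`. -/
noncomputable def swDistDensity (ε x y : ℝ) : ℝ :=
  if (swDistInterval ε x).1 ≤ y ∧ y < (swDistInterval ε x).2 then swDistP ε
  else swDistP ε / Real.exp ε

/-- The redesigned SW mechanism for distance perturbation is a valid
probability density and satisfies `ε`-LDP on `[0,1)`. -/
theorem swDist_valid_and_LDP (ε : ℝ) (hε : 0 < ε) :
    swDistP ε * (2 * swDistC ε) + (swDistP ε / Real.exp ε) * (1 - 2 * swDistC ε) = 1 ∧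
    (∀ x₁ x₂ y : ℝ, x₁ ∈ Set.Ico (0:ℝ) 1 → x₂ ∈ Set.Ico (0:ℝ) 1 →
      y ∈ Set.Ico (0:ℝ) 1 →
      swDistDensity ε x₁ y ≤ Real.exp ε * swDistDensity ε x₂ y) := by
  have hE : 1 < Real.exp ε := Real.one_lt_exp_iff.mpr hε
  have hp : 0 < swDistP ε := div_pos (sub_pos.mpr hE) hε
  refine ⟨?_, fun x₁ x₂ y _ _ _ => ?_⟩
  · have hE1 : Real.exp ε - 1 ≠ 0 := (sub_pos.mpr hE).ne'
    unfold swDistP swDistC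
    field_simp
    ring
  · have upper : swDistDensity ε x₁ y ≤ swDistP ε := by
      unfold swDistDensity
      split_ifs
      exacts [le_rfl, div_le_self hp.le hE.le]
    have lower : swDistP ε / Real.exp ε ≤ swDistDensity ε x₂ y := by
      unfold swDistDensity
      split_ifs
      exacts [div_le_self hp.le hE.le, le_rfl]
    exact upper.trans ((div_le_iff₀' (Real.exp_pos ε)).mp lower)
end
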